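/- Let $d \ge 3$ be an integer, let $k$ be an integer with $k \ge 100 d \log_2(10 d)$, and let $\widehat N \ge 1$ be a real number with $2^{-k}\widehat N^d \ge 2$. Let $x \in \mathbb{Z}^d$, let $A \subseteq B_x(2\widehat N)$ be a finite set of lattice points with $|A| \ge 2^{-k}\widehat N^d$, and let the integer $l \ge 1$ satisfy $\sum_{y \in A_l} |x-y|^{2-d} \ge \tfrac12 l^{-2} \sum_{y \in A \setminus \{x\}} |x-y|^{2-d}$, where $A_l := A \cap (B_x(2^{2-l}\widehat N)\setminus B_x(2^{1-l}\widehat N))$. Then for every subset $A' \subseteq A_l$ obtained by removing at most $2^{-k^{60d}}\cdot 3^d\,\widehat N^d$ points, i.e. with $|A_l \setminus A'| \le 2^{-k^{60d}}\, 3^d\, \widehat N^d$, one has $\sum_{y \in A'} |x-y|^{2-d} \ge \tfrac12 \sum_{y \in A_l} |x-y|^{2-d}$. -/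

import Mathlib

open Classical

/-- Euclidean distance between two points of `ℤ^d`. -/
noncomputable def eDist (d : ℕ) (x y : Fin d → ℤ) : ℝ :=
  Real.sqrt (∑ i, ((x i - y i : ℤ) : ℝ) ^ 2)

/-- `|x-y|^a` with the convention `0^a := 1` (used for negative exponents `a`). -/
noncomputable def invPow (d : ℕ) (a : ℝ) (x y : Fin d → ℤ) : ℝ :=
  if x = y then 1 else (eDist d x y) ^ a

/-- `y ∈ B_x(r)`, the sup-norm box of radius `r` centered at `x`. -/
def inBox (d : ℕ) (x : Fin d → ℤ) (r : ℝ) (y : Fin d → ℤ) : Prop :=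
  ∀ i, |((y i - x i : ℤ) : ℝ)| ≤ r

theorem abs_le_eDist (d : ℕ) (x y : Fin d → ℤ) (i : Fin d) :
    |((y i - x i : ℤ) : ℝ)| ≤ eDist d x y := by
  refine Real.abs_le_sqrt ?_
  have h := Finset.single_le_sum (f := fun i => ((x i - y i : ℤ) : ℝ) ^ 2)
    (fun j _ => sq_nonneg _) (Finset.mem_univ i)
  refine le_trans (le_of_eq ?_) h
  push_cast
  ring

theorem eDist_le_of_inBox {d : ℕ} {x y : Fin d → ℤ} {r : ℝ} (hr : 0 ≤ r)
    (h : inBox d x r y) : eDist d x y ≤ d * r := by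
  refine Real.sqrt_le_iff.2 ⟨by positivity, ?_⟩
  have hsum : ∑ i, ((x i - y i : ℤ) : ℝ) ^ 2 ≤ ∑ _i : Fin d, r ^ 2 := by
    refine Finset.sum_le_sum fun i _ => ?_
    rw [← sq_abs]
    have hi := h i
    rw [← neg_sub, Int.cast_neg, abs_neg] at hi
    gcongr
  rw [Finset.sum_const, Finset.card_univ, Fintype.card_fin, nsmul_eq_mul] at hsum
  have hd : (d : ℝ) ≤ (d : ℝ) ^ 2 := by exact_mod_cast Nat.le_self_pow two_ne_zero d
  calc _ ≤ (d : ℝ) * r ^ 2 := hsum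
    _ ≤ (d : ℝ) ^ 2 * r ^ 2 := by gcongr
    _ = _ := by ring

theorem eDist_pos {d : ℕ} {x y : Fin d → ℤ} (h : x ≠ y) : 0 < eDist d x y := by
  obtain ⟨i, hi⟩ := Function.ne_iff.1 h
  refine lt_of_lt_of_le (abs_pos.2 ?_) (abs_le_eDist d x y i)
  exact_mod_cast sub_ne_zero.2 (Ne.symm hi)

theorem ne_of_not_inBox {d : ℕ} {x y : Fin d → ℤ} {r : ℝ} (hr : 0 ≤ r)
    (h : ¬ inBox d x r y) : x ≠ y := by
  rintro rfl
  exact h fun i => by simpa using hr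

theorem invPow_neg_natCast {d : ℕ} {x y : Fin d → ℤ} (h : x ≠ y) (n : ℕ) :
    invPow d (-(n : ℝ)) x y = (eDist d x y ^ n)⁻¹ := by
  rw [invPow, if_neg h, Real.rpow_neg (eDist_pos h).le, Real.rpow_natCast]

theorem invPow_le_of_not_inBox {d : ℕ} {x y : Fin d → ℤ} {r : ℝ} (hr : 0 < r)
    (h : ¬ inBox d x r y) (n : ℕ) : invPow d (-(n : ℝ)) x y ≤ (r ^ n)⁻¹ := by
  rw [invPow_neg_natCast (ne_of_not_inBox hr.le h)]
  obtain ⟨i, hi⟩ := not_forall.1 h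
  have hle : r ≤ eDist d x y := (not_le.1 hi).le.trans (abs_le_eDist d x y i)
  gcongr

theorem le_invPow_of_inBox {d : ℕ} {x y : Fin d → ℤ} {r : ℝ} (hr : 0 ≤ r) (hxy : x ≠ y)
    (h : inBox d x r y) (n : ℕ) : ((d * r) ^ n)⁻¹ ≤ invPow d (-(n : ℝ)) x y := by
  rw [invPow_neg_natCast hxy]
  have hpos := eDist_pos hxy
  have hle := eDist_le_of_inBox hr h
  gcongr

theorem one_le_of_inBox {d : ℕ} {x y : Fin d → ℤ} {r : ℝ} (hxy : x ≠ y)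
    (h : inBox d x r y) : 1 ≤ r := by
  obtain ⟨i, hi⟩ := Function.ne_iff.1 hxy
  refine le_trans ?_ (h i)
  exact_mod_cast Int.one_le_abs (sub_ne_zero.2 (Ne.symm hi))

theorem card_le_of_inBox {d : ℕ} {x : Fin d → ℤ} {r : ℝ} (hr : 1 ≤ r)
    (S : Finset (Fin d → ℤ)) (hS : ∀ y ∈ S, inBox d x r y) :
    (S.card : ℝ) ≤ (3 * r) ^ d := by
  have hsub : S ⊆ Fintype.piFinset fun i => Finset.Icc (x i - ⌊r⌋₊) (x i + ⌊r⌋₊) := by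
    intro y hy
    refine Fintype.mem_piFinset.2 fun i => ?_
    have hi := hS y hy i
    rw [← Int.cast_abs, Int.abs_eq_natAbs, Int.cast_natCast] at hi
    have := Nat.le_floor hi
    rw [Finset.mem_Icc]
    omega
  have hcard := Finset.card_le_card hsub
  rw [Fintype.card_piFinset] at hcard
  have hI : ∀ i, (Finset.Icc (x i - ⌊r⌋₊) (x i + ⌊r⌋₊)).card = 2 * ⌊r⌋₊ + 1 := by
    intro i
    rw [Int.card_Icc]
    omega
  simp only [hI, Finset.prod_const, Finset.card_univ, Fintype.card_fin] at hcard
  have hfl := Nat.floor_le (zero_le_one.trans hr)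
  calc (S.card : ℝ) ≤ ((2 * ⌊r⌋₊ + 1 : ℕ) : ℝ) ^ d := by exact_mod_cast hcard
    _ ≤ (3 * r) ^ d := by
      gcongr
      push_cast
      linarith

theorem pow_le_two_pow_of_logb_le {d k : ℕ} (hd : 1 ≤ d)
    (hk : 100 * (d : ℝ) * Real.logb 2 (10 * d) ≤ (k : ℝ)) :
    (10 * d) ^ (100 * d) ≤ 2 ^ k := by
  have hpos : (0 : ℝ) < 10 * d := by positivity
  have h : Real.logb 2 ((10 * (d : ℝ)) ^ (100 * d)) ≤ k := by
    rw [Real.logb_pow]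
    push_cast
    exact hk
  rw [Real.logb_le_iff_le_rpow one_lt_two (by positivity), Real.rpow_natCast] at h
  exact_mod_cast h

theorem pow_four_lt_two_pow {l : ℕ} (hl : 24 ≤ l) : l ^ 4 < 2 ^ l := by
  induction l, hl using Nat.le_induction with
  | base => norm_num
  | succ l hl ih =>
    have : (l + 1) ^ 4 ≤ 2 * l ^ 4 := by
      have h1 : 24 * l ^ 3 ≤ l ^ 4 := by rw [pow_succ l 3]; nlinarith [Nat.zero_le (l ^ 3)]
      have h2 : 24 * l ^ 2 ≤ l ^ 3 := by rw [pow_succ l 2]; nlinarith [Nat.zero_le (l ^ 2)]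
      nlinarith
    rw [pow_succ 2]
    omega

theorem hundred_mul_le {d k : ℕ} (hd : 1 ≤ d) (hk : (10 * d) ^ (100 * d) ≤ 2 ^ k) :
    100 * d ≤ k :=
  (Nat.pow_le_pow_iff_right one_lt_two).1
    ((Nat.pow_le_pow_left (by omega) _).trans hk)

theorem scale_le {d k l : ℕ} (hd : 3 ≤ d) (hk : (10 * d) ^ (100 * d) ≤ 2 ^ k)
    (h : 4 ^ l ≤ l ^ 2 * 2 ^ k * (12 * d) ^ d) : l ≤ k := by
  by_contra! hlt
  have hk2 := hundred_mul_le (by omega) hk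
  have hT : ((12 * d) ^ d) ^ 2 ≤ 2 ^ l := by
    calc ((12 * d) ^ d) ^ 2 ≤ (((10 * d) ^ 2) ^ d) ^ 2 := by gcongr; nlinarith
      _ = (10 * d) ^ (4 * d) := by rw [← pow_mul, ← pow_mul]; ring_nf
      _ ≤ (10 * d) ^ (100 * d) := Nat.pow_le_pow_right (by omega) (by omega)
      _ ≤ 2 ^ k := hk
      _ ≤ 2 ^ l := Nat.pow_le_pow_right (by omega) hlt.le
  have hl4 := pow_four_lt_two_pow (l := l) (by omega)
  have h2 : 2 ^ l ≤ l ^ 2 * (12 * d) ^ d := by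
    have : 2 ^ l * 2 ^ l ≤ l ^ 2 * (12 * d) ^ d * 2 ^ l := by
      calc 2 ^ l * 2 ^ l = 4 ^ l := by rw [← mul_pow]; norm_num
        _ ≤ _ := h
        _ ≤ l ^ 2 * 2 ^ l * (12 * d) ^ d := by gcongr; omega
        _ = _ := by ring
    exact Nat.le_of_mul_le_mul_right this (by positivity)
  have h3 : 2 ^ l * 2 ^ l < 2 ^ l * 2 ^ l :=
    calc 2 ^ l * 2 ^ l ≤ (l ^ 2 * (12 * d) ^ d) * (l ^ 2 * (12 * d) ^ d) := Nat.mul_le_mul h2 h2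
      _ = l ^ 4 * ((12 * d) ^ d) ^ 2 := by ring
      _ < 2 ^ l * 2 ^ l := Nat.mul_lt_mul_of_lt_of_le hl4 hT (by positivity)
  exact lt_irrefl _ h3

theorem removal_bound {d k l n : ℕ} (hd : d = n + 2) (hk : 100 * d ≤ k) (hl : l ≤ k) :
    8 * l ^ 2 * 2 ^ k * (2 * d) ^ n * 3 ^ d * 2 ^ (l * n) ≤ 2 ^ (k ^ (60 * d)) := by
  have hkk : k < 2 ^ k := Nat.lt_two_pow_self
  have hnd : n ≤ d := by omega
  have hlk : l ≤ 2 ^ k := by omega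
  have hone : 1 ≤ 2 ^ k := Nat.one_le_two_pow
  calc 8 * l ^ 2 * 2 ^ k * (2 * d) ^ n * 3 ^ d * 2 ^ (l * n)
      ≤ 2 ^ k * (2 ^ k) ^ 2 * 2 ^ k * (2 ^ k) ^ d * (2 ^ k) ^ d * 2 ^ (k * d) := by
        gcongr
        · omega
        · omega
        · omega
        · norm_num
    _ = 2 ^ (4 * k + 3 * (k * d)) := by
        simp only [← pow_mul, ← pow_add]
        congr 1
        ring
    _ ≤ 2 ^ (k ^ (60 * d)) := by
        refine Nat.pow_le_pow_right two_pos ?_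
        calc 4 * k + 3 * (k * d) ≤ k ^ 3 := by nlinarith [Nat.mul_le_mul_left k hk]
          _ ≤ k ^ (60 * d) := Nat.pow_le_pow_right (by omega) (by omega)

theorem stmt_5 (d k : ℕ) (hd : 3 ≤ d)
    (hk : 100 * (d : ℝ) * Real.logb 2 (10 * d) ≤ (k : ℝ))
    (Nh : ℝ) (hN1 : 1 ≤ Nh) (hN2 : (2 : ℝ) ≤ (2 : ℝ) ^ (-(k : ℝ)) * Nh ^ (d : ℝ))
    (x : Fin d → ℤ) (A : Finset (Fin d → ℤ))
    (hA : ∀ y ∈ A, inBox d x (2 * Nh) y)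
    (hcard : (2 : ℝ) ^ (-(k : ℝ)) * Nh ^ (d : ℝ) ≤ (A.card : ℝ))
    (l : ℕ) (hl : 1 ≤ l)
    (Al : Finset (Fin d → ℤ))
    (hAl : Al = A.filter (fun y =>
      inBox d x ((2 : ℝ) ^ ((2 : ℝ) - l) * Nh) y ∧
      ¬ inBox d x ((2 : ℝ) ^ ((1 : ℝ) - l) * Nh) y))
    (hheavy : (1 / 2) * ((l : ℝ) ^ 2)⁻¹ * ∑ y ∈ A.erase x, invPow d (2 - d) x y ≤
      ∑ y ∈ Al, invPow d (2 - d) x y)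
    (A' : Finset (Fin d → ℤ)) (hsub : A' ⊆ Al)
    (hrem : (((Al \ A').card : ℕ) : ℝ) ≤
      (2 : ℝ) ^ (-((k : ℝ) ^ (60 * d))) * 3 ^ d * Nh ^ (d : ℝ)) :
    (1 / 2) * ∑ y ∈ Al, invPow d (2 - d) x y ≤ ∑ y ∈ A', invPow d (2 - d) x y := by
  obtain ⟨n, hn⟩ : ∃ n, d = n + 2 := ⟨d - 2, by omega⟩
  have hexp : (2 : ℝ) - d = -(n : ℝ) := by rw [hn]; push_cast; ring
  rw [hexp] at hheavy ⊢
  obtain ⟨R, hR⟩ : ∃ R : ℝ, Nh = R * 2 ^ l := ⟨Nh / 2 ^ l, by field_simp⟩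
  have hN0 : 0 < Nh := by linarith
  have hR0 : 0 < R := by
    rw [hR] at hN0
    exact pos_of_mul_pos_left hN0 (by positivity)
  have h4R : (2 : ℝ) ^ ((2 : ℝ) - l) * Nh = 4 * R := by
    rw [Real.rpow_sub two_pos, Real.rpow_natCast, Real.rpow_ofNat, hR]
    field_simp
    norm_num
  have h2R : (2 : ℝ) ^ ((1 : ℝ) - l) * Nh = 2 * R := by
    rw [Real.rpow_sub two_pos, Real.rpow_natCast, Real.rpow_one, hR]
    field_simp
  rw [h4R, h2R] at hAl
  have hK : (2 : ℝ) ^ (-((k : ℝ) ^ (60 * d))) = ((2 : ℝ) ^ (k ^ (60 * d)))⁻¹ := by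
    rw [Real.rpow_neg two_pos.le, ← Nat.cast_pow, Real.rpow_natCast]
  rw [hK, Real.rpow_natCast] at hrem
  rw [Real.rpow_neg two_pos.le, Real.rpow_natCast, Real.rpow_natCast] at hN2 hcard
  have hlR : (0 : ℝ) < l := by exact_mod_cast hl
  have hdR : (0 : ℝ) < d := by exact_mod_cast (by omega : 0 < d)
  have hin : ∀ y ∈ Al, inBox d x (4 * R) y ∧ ¬ inBox d x (2 * R) y := by
    intro y hy
    rw [hAl] at hy
    exact (Finset.mem_filter.1 hy).2
  have hpt : ∀ y ∈ Al, invPow d (-(n : ℝ)) x y ≤ ((2 * R) ^ n)⁻¹ := fun y hy =>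
    invPow_le_of_not_inBox (by positivity) (hin y hy).2 n
  have hlow : Nh ^ 2 / (4 * (l : ℝ) ^ 2 * 2 ^ k * (2 * d) ^ n) ≤
      ∑ y ∈ Al, invPow d (-(n : ℝ)) x y := by
    refine le_trans ?_ hheavy
    have hterm : ∀ y ∈ A.erase x, ((d * (2 * Nh)) ^ n)⁻¹ ≤ invPow d (-(n : ℝ)) x y := by
      intro y hy
      obtain ⟨hne, hyA⟩ := Finset.mem_erase.1 hy
      exact le_invPow_of_inBox (by positivity) (Ne.symm hne) (hA y hyA) n
    have hsum := Finset.card_nsmul_le_sum _ _ _ hterm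
    rw [nsmul_eq_mul] at hsum
    have hc : (A.card : ℝ) ≤ (A.erase x).card + 1 := by
      exact_mod_cast (Nat.sub_le_iff_le_add.1 Finset.pred_card_le_card_erase)
    have hhalf : ((2 : ℝ) ^ k)⁻¹ * Nh ^ d / 2 ≤ (A.erase x).card := by linarith
    calc Nh ^ 2 / (4 * (l : ℝ) ^ 2 * 2 ^ k * (2 * d) ^ n)
        = (1 / 2) * ((l : ℝ) ^ 2)⁻¹ *
            ((((2 : ℝ) ^ k)⁻¹ * Nh ^ d / 2) * ((d * (2 * Nh)) ^ n)⁻¹) := by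
          rw [show Nh ^ d = Nh ^ n * Nh ^ 2 by rw [← pow_add, hn],
            show (d * (2 * Nh)) ^ n = (2 * (d : ℝ)) ^ n * Nh ^ n by rw [← mul_pow]; ring]
          field_simp
          norm_num
      _ ≤ (1 / 2) * ((l : ℝ) ^ 2)⁻¹ * ((A.erase x).card * ((d * (2 * Nh)) ^ n)⁻¹) := by
          gcongr
      _ ≤ _ := by gcongr
  have hAlne : Al.Nonempty := by
    by_contra hemp
    rw [Finset.not_nonempty_iff_eq_empty] at hemp
    rw [hemp, Finset.sum_empty] at hlow
    have : 0 < Nh ^ 2 / (4 * (l : ℝ) ^ 2 * 2 ^ k * (2 * d) ^ n) := by positivity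
    linarith
  have h1R : 1 ≤ 4 * R := by
    obtain ⟨y, hy⟩ := hAlne
    exact one_le_of_inBox (ne_of_not_inBox (by positivity) (hin y hy).2) (hin y hy).1
  have hup : ∑ y ∈ Al, invPow d (-(n : ℝ)) x y ≤ 144 * 6 ^ n * R ^ 2 := by
    have hsum := Finset.sum_le_card_nsmul _ _ _ hpt
    rw [nsmul_eq_mul] at hsum
    have hc := card_le_of_inBox h1R Al fun y hy => (hin y hy).1
    calc _ ≤ _ := hsum
      _ ≤ (3 * (4 * R)) ^ d * ((2 * R) ^ n)⁻¹ := by gcongr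
      _ = 144 * 6 ^ n * R ^ 2 := by
        rw [show (3 * (4 * R)) ^ d = (6 : ℝ) ^ n * (2 * R) ^ n * (144 * R ^ 2) by
          rw [← mul_pow, hn, pow_add]; ring]
        field_simp
  have hkN := pow_le_two_pow_of_logb_le (by omega) hk
  have hlk : l ≤ k := by
    refine scale_le hd hkN ?_
    have h := hlow.trans hup
    rw [div_le_iff₀ (by positivity), hR] at h
    have h' : R ^ 2 * (4 : ℝ) ^ l ≤ R ^ 2 * (576 * l ^ 2 * 2 ^ k * (12 * d) ^ n) := by
      calc R ^ 2 * (4 : ℝ) ^ l = (R * 2 ^ l) ^ 2 := by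
            rw [mul_pow, ← pow_mul, mul_comm l 2, pow_mul]; norm_num
        _ ≤ _ := h
        _ = _ := by
          rw [show (12 * (d : ℝ)) ^ n = 6 ^ n * (2 * d) ^ n by rw [← mul_pow]; ring]
          ring
    have h'' := le_of_mul_le_mul_left h' (by positivity)
    have h3 : 4 ^ l ≤ 576 * l ^ 2 * 2 ^ k * (12 * d) ^ n := by exact_mod_cast h''
    calc 4 ^ l ≤ 576 * l ^ 2 * 2 ^ k * (12 * d) ^ n := h3
      _ ≤ (12 * d) ^ 2 * l ^ 2 * 2 ^ k * (12 * d) ^ n := by gcongr; nlinarith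
      _ = l ^ 2 * 2 ^ k * ((12 * d) ^ n * (12 * d) ^ 2) := by ring
      _ = l ^ 2 * 2 ^ k * (12 * d) ^ d := by rw [← pow_add, ← hn]
  have hremoved : ∑ y ∈ Al \ A', invPow d (-(n : ℝ)) x y ≤
      Nh ^ 2 / (8 * (l : ℝ) ^ 2 * 2 ^ k * (2 * d) ^ n) := by
    have hsum := Finset.sum_le_card_nsmul (Al \ A') _ _
      fun y hy => hpt y (Finset.sdiff_subset hy)
    rw [nsmul_eq_mul] at hsum
    have hb : (8 * (l : ℝ) ^ 2 * 2 ^ k * (2 * d) ^ n) * (3 ^ d * 2 ^ (l * n)) ≤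
        2 ^ (k ^ (60 * d)) := by
      have := removal_bound hn (hundred_mul_le (by omega) hkN) hlk
      rw [mul_assoc _ (3 ^ d)] at this
      exact_mod_cast this
    calc _ ≤ _ := hsum
      _ ≤ (((2 : ℝ) ^ (k ^ (60 * d)))⁻¹ * 3 ^ d * Nh ^ d) * (R ^ n)⁻¹ := by
        gcongr
        linarith
      _ = Nh ^ 2 * ((3 ^ d * 2 ^ (l * n)) / 2 ^ (k ^ (60 * d))) := by
        rw [show Nh ^ d = R ^ n * 2 ^ (l * n) * Nh ^ 2 by
          rw [pow_mul, ← mul_pow, ← hR, ← pow_add, hn]]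
        field_simp
      _ ≤ Nh ^ 2 * (1 / (8 * (l : ℝ) ^ 2 * 2 ^ k * (2 * d) ^ n)) := by
        refine mul_le_mul_of_nonneg_left ?_ (by positivity)
        rw [div_le_div_iff₀ (by positivity) (by positivity), one_mul, mul_comm]
        exact hb
      _ = _ := by ring
  have hhalf : Nh ^ 2 / (8 * (l : ℝ) ^ 2 * 2 ^ k * (2 * d) ^ n) =
      (1 / 2) * (Nh ^ 2 / (4 * (l : ℝ) ^ 2 * 2 ^ k * (2 * d) ^ n)) := by
    field_simp
    norm_num
  have hsplit := Finset.sum_sdiff (f := fun y => invPow d (-(n : ℝ)) x y) hsub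
  linarith
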